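/- Let s, t ≥ 0 with 0 < |t - s| < 1. Then the function z(x) = [Γ(x+t)/Γ(x+s)]^{1/(t-s)} − x is decreasing on (0, ∞). -/

import Mathlib

noncomputable def z (s t x : ℝ) : ℝ :=
  (Real.Gamma (x + t) / Real.Gamma (x + s)) ^ ((1 : ℝ) / (t - s)) - x

open Set Filter Topology

/-- A function that strictly decreases under `y ↦ y + 1` and is bounded below by `-C / y` is
positive. -/
theorem pos_of_add_one_lt {f : ℝ → ℝ} (C : ℝ) (hstep : ∀ y, 0 < y → f (y + 1) < f y)
    (hbound : ∀ y, 0 < y → -(C / y) ≤ f y) {y : ℝ} (hy : 0 < y) : 0 < f y := by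
  have hanti : ∀ (n : ℕ) {x : ℝ}, 0 < x → f (x + n) ≤ f x := by
    intro n
    induction n with
    | zero => simp
    | succ n ih =>
      intro x hx
      have h := hstep (x + n) (by positivity)
      push_cast
      rw [← add_assoc]
      exact h.le.trans (ih hx)
  have hlim : Tendsto (fun n : ℕ => -(C / (y + 1 + n))) atTop (𝓝 0) := by
    simpa using (tendsto_const_nhds.div_atTop
      (tendsto_atTop_add_const_left _ (y + 1) tendsto_natCast_atTop_atTop)).neg
  have h0 : 0 ≤ f (y + 1) := le_of_tendsto' hlim fun n =>
    (hbound (y + 1 + n) (by positivity)).trans (hanti n (by positivity))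
  exact h0.trans_lt (hstep y hy)

/-- The derivative of `log Γ` on the real line. -/
noncomputable def realDigamma (y : ℝ) : ℝ := deriv (Real.log ∘ Real.Gamma) y

theorem differentiableAt_log_Gamma {y : ℝ} (hy : 0 < y) :
    DifferentiableAt ℝ (Real.log ∘ Real.Gamma) y := by
  refine (Real.differentiableAt_log (Real.Gamma_pos_of_pos hy).ne').comp y
    (Real.differentiableAt_Gamma fun m => ?_)
  have : (0 : ℝ) ≤ m := m.cast_nonneg
  linarith

theorem hasDerivAt_log_Gamma {y : ℝ} (hy : 0 < y) :
    HasDerivAt (Real.log ∘ Real.Gamma) (realDigamma y) y :=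
  (differentiableAt_log_Gamma hy).hasDerivAt

theorem log_Gamma_add_one {y : ℝ} (hy : 0 < y) :
    (Real.log ∘ Real.Gamma) (y + 1) = Real.log y + (Real.log ∘ Real.Gamma) y := by
  simp only [Function.comp_apply]
  rw [Real.Gamma_add_one hy.ne', Real.log_mul hy.ne' (Real.Gamma_pos_of_pos hy).ne']

theorem realDigamma_add_one {y : ℝ} (hy : 0 < y) :
    realDigamma (y + 1) = realDigamma y + 1 / y := by
  have h₁ : HasDerivAt (fun x => (Real.log ∘ Real.Gamma) (x + 1)) (realDigamma (y + 1)) y :=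
    (hasDerivAt_log_Gamma (by positivity : 0 < y + 1)).comp_add_const y 1
  have h₂ := (Real.hasDerivAt_log hy.ne').add (hasDerivAt_log_Gamma hy)
  have heq : (fun x => (Real.log ∘ Real.Gamma) (x + 1)) =ᶠ[𝓝 y]
      (Real.log + (Real.log ∘ Real.Gamma)) := by
    filter_upwards [lt_mem_nhds hy] with x hx using log_Gamma_add_one hx
  rw [(h₁.congr_of_eventuallyEq heq.symm).unique h₂, one_div, add_comm]

theorem realDigamma_mono {a b : ℝ} (ha : 0 < a) (hab : a ≤ b) :
    realDigamma a ≤ realDigamma b :=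
  Real.convexOn_log_Gamma.monotoneOn_deriv (fun _ hx => differentiableAt_log_Gamma hx)
    ha (ha.trans_le hab) hab

/-- The logarithm of `(Γ(y+d)/Γ(y))^(1/d)`. -/
noncomputable def logGammaSlope (d y : ℝ) : ℝ :=
  ((Real.log ∘ Real.Gamma) (y + d) - (Real.log ∘ Real.Gamma) y) / d

/-- The divided difference of `realDigamma` with step `d`. -/
noncomputable def digammaSlope (d y : ℝ) : ℝ :=
  (realDigamma (y + d) - realDigamma y) / d

section

variable {d : ℝ}

theorem hasDerivAt_logGammaSlope (hd : 0 < d) {y : ℝ} (hy : 0 < y) :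
    HasDerivAt (logGammaSlope d) (digammaSlope d y) y :=
  (((hasDerivAt_log_Gamma (by positivity : 0 < y + d)).comp_add_const y d).sub
    (hasDerivAt_log_Gamma hy)).div_const d

theorem logGammaSlope_le_log (hd : 0 < d) (hd1 : d < 1) {y : ℝ} (hy : 0 < y) :
    logGammaSlope d y ≤ Real.log y := by
  have h := Real.convexOn_log_Gamma.2 (mem_Ioi.2 hy) (mem_Ioi.2 (by positivity : 0 < y + 1))
    (sub_nonneg.2 hd1.le) hd.le (by ring)
  simp only [smul_eq_mul] at h
  rw [log_Gamma_add_one hy, show (1 - d) * y + d * (y + 1) = y + d by ring] at h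
  rw [logGammaSlope, div_le_iff₀ hd]
  linarith

theorem digammaSlope_add_one (hd : 0 < d) {y : ℝ} (hy : 0 < y) :
    digammaSlope d (y + 1) = digammaSlope d y - 1 / (y * (y + d)) := by
  rw [digammaSlope, digammaSlope, show y + 1 + d = y + d + 1 by ring, realDigamma_add_one hy,
    realDigamma_add_one (by positivity : 0 < y + d)]
  field_simp
  ring

theorem digammaSlope_le (hd : 0 < d) (hd1 : d < 1) {y : ℝ} (hy : 0 < y) :
    digammaSlope d y ≤ 1 / d / y := by
  have h := realDigamma_mono (by positivity : 0 < y + d) (by linarith : y + d ≤ y + 1)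
  rw [realDigamma_add_one hy] at h
  rw [digammaSlope, div_div, mul_comm, ← div_div]
  gcongr
  linarith

theorem digammaSlope_nonneg (hd : 0 < d) {y : ℝ} (hy : 0 < y) : 0 ≤ digammaSlope d y :=
  div_nonneg (sub_nonneg.2 (realDigamma_mono hy (by linarith))) hd.le

theorem lt_digammaSlope (hd : 0 < d) (hd1 : d < 1) {y : ℝ} (hy : 0 < y) :
    1 / (y * (y + d)) * ((2 * y + d + 1) / 2) < digammaSlope d y := by
  rw [← sub_pos]
  refine pos_of_add_one_lt (f := fun y => digammaSlope d y -
    1 / (y * (y + d)) * ((2 * y + d + 1) / 2)) (1 + 1 / d) (fun y hy => ?_) (fun y hy => ?_) hy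
  · rw [digammaSlope_add_one hd hy, ← sub_pos]
    have key : digammaSlope d y - 1 / (y * (y + d)) * ((2 * y + d + 1) / 2) -
        (digammaSlope d y - 1 / (y * (y + d)) -
          1 / ((y + 1) * (y + 1 + d)) * ((2 * (y + 1) + d + 1) / 2)) =
        (1 - d) * (1 + d) / (2 * (y * (y + d)) * ((y + 1) * (y + 1 + d))) := by
      field_simp
      ring
    rw [key]
    have := sub_pos.2 hd1
    positivity
  · have h := digammaSlope_nonneg hd hy
    have h' : 1 / (y * (y + d)) * ((2 * y + d + 1) / 2) ≤ (1 + 1 / d) / y := by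
      rw [← sub_nonneg]
      have key : (1 + 1 / d) / y - 1 / (y * (y + d)) * ((2 * y + d + 1) / 2) =
          (d * d + 2 * y + d) / (2 * d * y * (y + d)) := by
        field_simp
        ring
      rw [key]
      positivity
    linarith

theorem digammaSlope_pos (hd : 0 < d) (hd1 : d < 1) {y : ℝ} (hy : 0 < y) :
    0 < digammaSlope d y :=
  lt_trans (by positivity) (lt_digammaSlope hd hd1 hy)

theorem digammaSlope_add_one_lt (hd : 0 < d) (hd1 : d < 1) {y : ℝ} (hy : 0 < y) :
    digammaSlope d (y + 1) < 1 / y := by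
  rw [← sub_pos]
  refine pos_of_add_one_lt (f := fun y => 1 / y - digammaSlope d (y + 1)) (1 / d)
    (fun y hy => ?_) (fun y hy => ?_) hy
  · rw [digammaSlope_add_one hd (by positivity : 0 < y + 1), ← sub_pos]
    have key : 1 / y - digammaSlope d (y + 1) - (1 / (y + 1) - (digammaSlope d (y + 1) -
        1 / ((y + 1) * (y + 1 + d)))) = (1 + d) / (y * (y + 1) * (y + 1 + d)) := by
      field_simp
      ring
    rw [key]
    positivity
  · have h := digammaSlope_le hd hd1 (by positivity : 0 < y + 1)
    have h' : 1 / d / (y + 1) ≤ 1 / d / y := by gcongr; linarith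
    have h'' : 0 < 1 / y := by positivity
    linarith

/-- Equivalently, `1 / digammaSlope d y - y` is strictly decreasing. -/
theorem digammaSlope_sub_lt (hd : 0 < d) (hd1 : d < 1) {a b : ℝ} (ha : 0 < a) (hab : a < b) :
    digammaSlope d a < digammaSlope d b * (1 + (b - a) * digammaSlope d a) := by
  obtain ⟨h, rfl⟩ : ∃ h, b = a + h := ⟨b - a, by ring⟩
  have hh : 0 < h := by linarith
  rw [← sub_pos, show a + h - a = h by ring]
  refine pos_of_add_one_lt (f := fun y =>
    digammaSlope d (y + h) * (1 + h * digammaSlope d y) - digammaSlope d y) (1 / d)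
    (fun y hy => ?_) (fun y hy => ?_) ha
  · have hyh : 0 < y + h := by positivity
    have hp := lt_digammaSlope hd hd1 hy
    have hq := lt_digammaSlope hd hd1 hyh
    rw [show y + 1 + h = y + h + 1 by ring, digammaSlope_add_one hd hy,
      digammaSlope_add_one hd hyh]
    have hdiff : 1 / (y * (y + d)) - 1 / ((y + h) * (y + h + d)) =
        h * (1 / (y * (y + d)) * (1 / ((y + h) * (y + h + d)))) * (2 * y + h + d) := by
      field_simp
      ring
    have hp0 : 0 < 1 / (y * (y + d)) := by positivity
    have hq0 : 0 < 1 / ((y + h) * (y + h + d)) := by positivity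
    generalize 1 / (y * (y + d)) = p at *
    generalize 1 / ((y + h) * (y + h + d)) = q at *
    have h₁ := mul_pos (mul_pos hh hq0) (sub_pos.2 hp)
    have h₂ := mul_pos (mul_pos hh hp0) (sub_pos.2 hq)
    linarith
  · have h₁ := digammaSlope_le hd hd1 hy
    have h₂ := digammaSlope_nonneg hd hy
    have h₃ := digammaSlope_nonneg hd (by positivity : 0 < y + h)
    have h₄ : 0 ≤ digammaSlope d (y + h) * (1 + h * digammaSlope d y) := by positivity
    linarith

theorem log_le_logGammaSlope_sub (hd : 0 < d) (hd1 : d < 1) {a b : ℝ} (ha : 0 < a)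
    (hab : a ≤ b) :
    Real.log (1 + (b - a) * digammaSlope d a) ≤ logGammaSlope d b - logGammaSlope d a := by
  have hφ := digammaSlope_pos hd hd1 ha
  have hpos : ∀ x ∈ Ici a, 0 < 1 + (x - a) * digammaSlope d a := fun x hx => by
    have := sub_nonneg.2 (mem_Ici.1 hx)
    positivity
  have hderiv : ∀ x ∈ Ici a, HasDerivAt
      (fun x => logGammaSlope d x - Real.log (1 + (x - a) * digammaSlope d a))
      (digammaSlope d x - digammaSlope d a / (1 + (x - a) * digammaSlope d a)) x :=
    fun x hx => by
      have h := ((((hasDerivAt_id x).sub_const a).mul_const (digammaSlope d a)).const_add 1).log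
        (hpos x hx).ne'
      rw [one_mul] at h
      exact (hasDerivAt_logGammaSlope hd (ha.trans_le hx)).sub h
  have hmono := monotoneOn_of_deriv_nonneg (convex_Ici a)
    (fun x hx => (hderiv x hx).continuousAt.continuousWithinAt)
    (fun x hx => (hderiv x (interior_subset hx)).differentiableAt.differentiableWithinAt)
    (fun x hx => by
      rw [(hderiv x (interior_subset hx)).deriv, sub_nonneg,
        div_le_iff₀ (hpos x (interior_subset hx))]
      rw [interior_Ici] at hx
      exact (digammaSlope_sub_lt hd hd1 ha hx).le)
  have h := hmono self_mem_Ici (mem_Ici.2 hab) hab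
  simp only [sub_self, zero_mul, add_zero, Real.log_one, sub_zero] at h
  linarith

theorem exp_logGammaSlope_mul_digammaSlope_strictMonoOn (hd : 0 < d) (hd1 : d < 1) :
    StrictMonoOn (fun y => Real.exp (logGammaSlope d y) * digammaSlope d y) (Ioi 0) := by
  intro a ha b hb hab
  rw [mem_Ioi] at ha hb
  have hφ := digammaSlope_pos hd hd1 ha
  have hφb := digammaSlope_pos hd hd1 hb
  have hpos : 0 < 1 + (b - a) * digammaSlope d a := by
    have := sub_pos.2 hab
    positivity
  have h := log_le_logGammaSlope_sub hd hd1 ha hab.le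
  rw [Real.log_le_iff_le_exp hpos, Real.exp_sub, le_div_iff₀ (Real.exp_pos _)] at h
  calc Real.exp (logGammaSlope d a) * digammaSlope d a
      < Real.exp (logGammaSlope d a) *
          (digammaSlope d b * (1 + (b - a) * digammaSlope d a)) := by
        gcongr
        exact digammaSlope_sub_lt hd hd1 ha hab
    _ = (1 + (b - a) * digammaSlope d a) * Real.exp (logGammaSlope d a) *
          digammaSlope d b := by ring
    _ ≤ Real.exp (logGammaSlope d b) * digammaSlope d b := by gcongr

theorem exp_logGammaSlope_mul_digammaSlope_lt_one (hd : 0 < d) (hd1 : d < 1) {y : ℝ}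
    (hy : 0 < y) : Real.exp (logGammaSlope d y) * digammaSlope d y < 1 := by
  have hmono : ∀ y, 0 < y → Real.exp (logGammaSlope d y) * digammaSlope d y <
      Real.exp (logGammaSlope d (y + 1)) * digammaSlope d (y + 1) := fun y hy =>
    exp_logGammaSlope_mul_digammaSlope_strictMonoOn hd hd1 (mem_Ioi.2 hy)
      (mem_Ioi.2 (by positivity)) (by linarith)
  refine (hmono y hy).trans ?_
  rw [← sub_pos]
  refine pos_of_add_one_lt (f := fun y =>
    1 - Real.exp (logGammaSlope d (y + 1)) * digammaSlope d (y + 1)) 1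
    (fun y hy => ?_) (fun y hy => ?_) hy
  · have := hmono (y + 1) (by positivity)
    linarith
  · have hy1 : 0 < y + 1 := by positivity
    have hexp : Real.exp (logGammaSlope d (y + 1)) ≤ y + 1 :=
      (Real.le_log_iff_exp_le hy1).1 (logGammaSlope_le_log hd hd1 hy1)
    have h : Real.exp (logGammaSlope d (y + 1)) * digammaSlope d (y + 1) ≤ (y + 1) * (1 / y) :=
      mul_le_mul hexp (digammaSlope_add_one_lt hd hd1 hy).le (digammaSlope_nonneg hd hy1) hy1.le
    have h' : (y + 1) * (1 / y) = 1 + 1 / y := by field_simp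
    linarith

theorem exp_logGammaSlope_sub_id_strictAntiOn (hd : 0 < d) (hd1 : d < 1) :
    StrictAntiOn (fun y => Real.exp (logGammaSlope d y) - y) (Ioi 0) := by
  have hderiv : ∀ y ∈ Ioi (0 : ℝ), HasDerivAt (fun y => Real.exp (logGammaSlope d y) - y)
      (Real.exp (logGammaSlope d y) * digammaSlope d y - 1) y := fun y hy =>
    (hasDerivAt_logGammaSlope hd hy).exp.sub (hasDerivAt_id y)
  refine strictAntiOn_of_deriv_neg (convex_Ioi 0)
    (fun y hy => (hderiv y hy).continuousAt.continuousWithinAt) (fun y hy => ?_)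
  rw [interior_Ioi] at hy
  rw [(hderiv y hy).deriv, sub_neg]
  exact exp_logGammaSlope_mul_digammaSlope_lt_one hd hd1 hy

end

theorem z_eq_exp_logGammaSlope {s t x : ℝ} (hs : 0 ≤ s) (ht : 0 ≤ t) (hx : 0 < x) :
    z s t x = Real.exp (logGammaSlope (t - s) (x + s)) - x := by
  have hΓs : 0 < Real.Gamma (x + s) := Real.Gamma_pos_of_pos (by positivity)
  have hΓt : 0 < Real.Gamma (x + t) := Real.Gamma_pos_of_pos (by positivity)
  rw [z, Real.rpow_def_of_pos (div_pos hΓt hΓs), Real.log_div hΓt.ne' hΓs.ne', logGammaSlope,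
    show x + s + (t - s) = x + t by ring, mul_one_div]
  rfl

theorem z_comm {s t x : ℝ} (hs : 0 ≤ s) (ht : 0 ≤ t) (hx : 0 < x) : z s t x = z t s x := by
  rw [z_eq_exp_logGammaSlope hs ht hx, z_eq_exp_logGammaSlope ht hs hx, logGammaSlope,
    logGammaSlope, show x + s + (t - s) = x + t by ring, show x + t + (s - t) = x + s by ring,
    ← neg_sub t s, div_neg, ← neg_div, neg_sub]

theorem z_strictAntiOn_of_lt {s t : ℝ} (hs : 0 ≤ s) (hst : s < t) (h1 : t - s < 1) :
    StrictAntiOn (z s t) (Ioi 0) := by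
  intro a ha b hb hab
  rw [mem_Ioi] at ha hb
  have h := exp_logGammaSlope_sub_id_strictAntiOn (sub_pos.2 hst) h1
    (mem_Ioi.2 (by positivity : 0 < a + s)) (mem_Ioi.2 (by positivity : 0 < b + s))
    (by linarith : a + s < b + s)
  rw [z_eq_exp_logGammaSlope hs (hs.trans hst.le) ha,
    z_eq_exp_logGammaSlope hs (hs.trans hst.le) hb]
  simp only at h
  linarith

theorem z_decreasing (s t : ℝ) (hs : 0 ≤ s) (ht : 0 ≤ t)
    (h0 : 0 < |t - s|) (h1 : |t - s| < 1) :
    StrictAntiOn (z s t) (Set.Ioi 0) := by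
  rcases lt_or_gt_of_ne (sub_ne_zero.1 (abs_pos.1 h0)) with h | h
  · exact (z_strictAntiOn_of_lt ht h (by linarith [neg_abs_le (t - s)])).congr
      fun x hx => z_comm ht hs hx
  · exact z_strictAntiOn_of_lt hs h ((le_abs_self _).trans_lt h1)
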